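/- Let m₁, …, m₇ be natural numbers with 8 ∣ m₁, 4 ∣ m₂, 8 ∣ m₃, 2 ∣ m₄, 8 ∣ m₅, 4 ∣ m₆, 8 ∣ m₇, let n = m₁ + m₂ + ⋯ + m₇, and let BRep be the block repetition code of length n over ZMod 8 generated (as a Z8-submodule of (Fin n → ZMod 8)) by the single vector g whose first m₁ coordinates are 1, next m₂ coordinates are 2, next m₃ coordinates are 3, next m₄ coordinates are 4, next m₅ coordinates are 5, next m₆ coordinates are 6, and last m₇ coordinates are 7 (so BRep = {k·g : k ∈ ZMod 8}). Then 2·r_E(BRep) = 11·(m₁ + m₃ + m₅ + m₇) + 12·(m₂ + m₆) + 16·m₄. -/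

import Mathlib

open Finset

/-- Homogeneous weight on `ZMod 8`. -/
def wHW (x : ZMod 8) : ℕ := if x = 0 then 0 else if x = 4 then 4 else 2

/-- Lee weight on `ZMod 8`. -/
def wL (x : ZMod 8) : ℕ := min x.val (8 - x.val)

/-- Euclidean weight on `ZMod 8`. -/
def wE (x : ZMod 8) : ℕ := min (x.val ^ 2) ((8 - x.val) ^ 2)

/-- The distance on `Fin n → ZMod 8` induced by a weight `w` on `ZMod 8`. -/
def distOf (w : ZMod 8 → ℕ) {n : ℕ} (x y : Fin n → ZMod 8) : ℕ := ∑ i, w (x i - y i)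

/-- The covering radius of a code `C ⊆ α` with respect to a distance `d`:
the maximum over all `u` of the minimum distance from `u` to the code. -/
noncomputable def covRadius {α : Type*} [Fintype α] (d : α → α → ℕ) (C : Set α) : ℕ :=
  ⨆ u : α, sInf {r | ∃ c ∈ C, r = d u c}

/-- The generator of the block repetition code: first `m₁` coordinates `1`,
next `m₂` coordinates `2`, …, last `m₇` coordinates `7`. -/
def blockVec (m₁ m₂ m₃ m₄ m₅ m₆ m₇ : ℕ) :
    Fin (m₁ + m₂ + m₃ + m₄ + m₅ + m₆ + m₇) → ZMod 8 := fun i =>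
  if (i : ℕ) < m₁ then 1
  else if (i : ℕ) < m₁ + m₂ then 2
  else if (i : ℕ) < m₁ + m₂ + m₃ then 3
  else if (i : ℕ) < m₁ + m₂ + m₃ + m₄ then 4
  else if (i : ℕ) < m₁ + m₂ + m₃ + m₄ + m₅ then 5
  else if (i : ℕ) < m₁ + m₂ + m₃ + m₄ + m₅ + m₆ then 6
  else 7

/-- Twice the largest average Euclidean distance from an element of `ZMod 8` to the
multiset `{k * r | k : ZMod 8}`. -/
def maxAverage (r : ZMod 8) : ℕ :=
  if r = 0 then 32 else if r = 4 then 16 else if r = 2 ∨ r = 6 then 12 else 11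

theorem two_mul_sum_wE_le (a r : ZMod 8) :
    2 * ∑ k : ZMod 8, wE (a - k * r) ≤ 8 * maxAverage r := by
  revert a r
  decide

theorem sum_blockVec (m₁ m₂ m₃ m₄ m₅ m₆ m₇ : ℕ) (f : ℕ → ZMod 8 → ℕ) :
    ∑ i : Fin (m₁ + m₂ + m₃ + m₄ + m₅ + m₆ + m₇), f i (blockVec m₁ m₂ m₃ m₄ m₅ m₆ m₇ i) =
      ∑ i ∈ range m₁, f i 1 + ∑ i ∈ range m₂, f (m₁ + i) 2 +
      ∑ i ∈ range m₃, f (m₁ + m₂ + i) 3 + ∑ i ∈ range m₄, f (m₁ + m₂ + m₃ + i) 4 +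
      ∑ i ∈ range m₅, f (m₁ + m₂ + m₃ + m₄ + i) 5 +
      ∑ i ∈ range m₆, f (m₁ + m₂ + m₃ + m₄ + m₅ + i) 6 +
      ∑ i ∈ range m₇, f (m₁ + m₂ + m₃ + m₄ + m₅ + m₆ + i) 7 := by
  unfold blockVec
  rw [Fin.sum_univ_eq_sum_range (fun i => f i (
    if i < m₁ then 1
    else if i < m₁ + m₂ then 2
    else if i < m₁ + m₂ + m₃ then 3
    else if i < m₁ + m₂ + m₃ + m₄ then 4
    else if i < m₁ + m₂ + m₃ + m₄ + m₅ then 5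
    else if i < m₁ + m₂ + m₃ + m₄ + m₅ + m₆ then 6
    else 7))]
  simp only [sum_range_add]
  congr! 7 with i hi i hi i hi i hi i hi i hi i hi <;> rw [mem_range] at hi
  all_goals
    congr 1
    split_ifs <;> first | rfl | omega

/-- If every window of length `p` has the same average distance, then so does every block
whose length is a multiple of `p`. -/
theorem two_mul_sum_range_wE {p c : ℕ} {r : ZMod 8}
    (h : ∀ k a : ZMod 8, 2 * ∑ x ∈ range p, wE (r * (a + x) - k * r) = p * c)
    {m : ℕ} (hm : p ∣ m) (k : ZMod 8) (a : ℕ) :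
    2 * ∑ i ∈ range m, wE (r * ((a + i : ℕ) : ZMod 8) - k * r) = c * m := by
  obtain ⟨q, rfl⟩ := hm
  induction q with
  | zero => simp
  | succ q ih =>
    have h' := h k ((a + p * q : ℕ) : ZMod 8)
    rw [mul_add_one, sum_range_add, mul_add, ih]
    simp only [Nat.cast_add, add_assoc] at h' ⊢
    rw [h']
    ring

/-- The vector `i ↦ i * gᵢ`, with `g` the generator, is equidistant from all codewords. -/
theorem two_mul_distOf_wE_blockVec {m₁ m₂ m₃ m₄ m₅ m₆ m₇ : ℕ}
    (h₁ : 8 ∣ m₁) (h₂ : 4 ∣ m₂) (h₃ : 8 ∣ m₃) (h₄ : 2 ∣ m₄)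
    (h₅ : 8 ∣ m₅) (h₆ : 4 ∣ m₆) (h₇ : 8 ∣ m₇) (k : ZMod 8) :
    2 * distOf wE (fun i => blockVec m₁ m₂ m₃ m₄ m₅ m₆ m₇ i * ((i : ℕ) : ZMod 8))
        (k • blockVec m₁ m₂ m₃ m₄ m₅ m₆ m₇) =
      11 * (m₁ + m₃ + m₅ + m₇) + 12 * (m₂ + m₆) + 16 * m₄ := by
  simp only [distOf, Pi.smul_apply, smul_eq_mul]
  rw [sum_blockVec m₁ m₂ m₃ m₄ m₅ m₆ m₇ fun i r => wE (r * (i : ZMod 8) - k * r)]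
  have e₁ := two_mul_sum_range_wE (c := 11) (r := 1) (by decide) h₁ k 0
  have e₂ := two_mul_sum_range_wE (c := 12) (r := 2) (by decide) h₂ k m₁
  have e₃ := two_mul_sum_range_wE (c := 11) (r := 3) (by decide) h₃ k (m₁ + m₂)
  have e₄ := two_mul_sum_range_wE (c := 16) (r := 4) (by decide) h₄ k
    (m₁ + m₂ + m₃)
  have e₅ := two_mul_sum_range_wE (c := 11) (r := 5) (by decide) h₅ k
    (m₁ + m₂ + m₃ + m₄)
  have e₆ := two_mul_sum_range_wE (c := 12) (r := 6) (by decide) h₆ k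
    (m₁ + m₂ + m₃ + m₄ + m₅)
  have e₇ := two_mul_sum_range_wE (c := 11) (r := 7) (by decide) h₇ k
    (m₁ + m₂ + m₃ + m₄ + m₅ + m₆)
  simp only [zero_add] at e₁
  linarith

theorem sum_maxAverage_blockVec (m₁ m₂ m₃ m₄ m₅ m₆ m₇ : ℕ) :
    ∑ i, maxAverage (blockVec m₁ m₂ m₃ m₄ m₅ m₆ m₇ i) =
      11 * (m₁ + m₃ + m₅ + m₇) + 12 * (m₂ + m₆) + 16 * m₄ := by
  rw [sum_blockVec m₁ m₂ m₃ m₄ m₅ m₆ m₇ fun _ r => maxAverage r]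
  simp only [sum_const, card_range, smul_eq_mul, show maxAverage 1 = 11 by decide,
    show maxAverage 2 = 12 by decide, show maxAverage 3 = 11 by decide,
    show maxAverage 4 = 16 by decide, show maxAverage 5 = 11 by decide,
    show maxAverage 6 = 12 by decide, show maxAverage 7 = 11 by decide]
  ring

theorem two_mul_sum_distOf_wE_le {n : ℕ} (u g : Fin n → ZMod 8) :
    2 * ∑ k : ZMod 8, distOf wE u (k • g) ≤ 8 * ∑ i, maxAverage (g i) := by
  simp only [distOf, Pi.smul_apply, smul_eq_mul]
  rw [sum_comm, mul_sum, mul_sum]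
  exact sum_le_sum fun i _ => two_mul_sum_wE_le (u i) (g i)

/-- A vector equidistant from all multiples of `g`, at the largest distance allowed by
averaging, determines the covering radius of the code generated by `g`. -/
theorem two_mul_covRadius_span_singleton {n : ℕ} {u g : Fin n → ZMod 8}
    (hu : ∀ k : ZMod 8, 2 * distOf wE u (k • g) = ∑ i, maxAverage (g i)) :
    2 * covRadius (distOf wE) (Submodule.span (ZMod 8) {g} : Set (Fin n → ZMod 8)) =
      ∑ i, maxAverage (g i) := by
  set C : Set (Fin n → ZMod 8) := ↑(Submodule.span (ZMod 8) {g})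
  let dist (v : Fin n → ZMod 8) : ℕ := sInf {r | ∃ c ∈ C, r = distOf wE v c}
  change 2 * (⨆ v, dist v) = _
  apply le_antisymm
  · obtain ⟨v, hv⟩ := exists_eq_ciSup_of_finite (f := dist)
    rw [← hv]
    have hle (k : ZMod 8) : dist v ≤ distOf wE v (k • g) :=
      Nat.sInf_le ⟨k • g, Submodule.smul_mem _ k (Submodule.mem_span_singleton_self g), rfl⟩
    have hcard := card_nsmul_le_sum univ _ _ fun k _ => hle k
    rw [card_univ, ZMod.card, smul_eq_mul] at hcard
    linarith [two_mul_sum_distOf_wE_le v g]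
  · obtain ⟨c, hc, hr⟩ := Nat.sInf_mem (s := {r | ∃ c ∈ C, r = distOf wE u c})
      ⟨_, 0, Submodule.zero_mem _, rfl⟩
    obtain ⟨k, rfl⟩ := Submodule.mem_span_singleton.mp hc
    rw [← hu k]
    refine Nat.mul_le_mul_left 2 (hr.symm.le.trans ?_)
    exact le_ciSup (Set.finite_range dist).bddAbove u

theorem covRadius_euclidean_block_repetition
    (m₁ m₂ m₃ m₄ m₅ m₆ m₇ : ℕ)
    (h₁ : 8 ∣ m₁) (h₂ : 4 ∣ m₂) (h₃ : 8 ∣ m₃) (h₄ : 2 ∣ m₄)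
    (h₅ : 8 ∣ m₅) (h₆ : 4 ∣ m₆) (h₇ : 8 ∣ m₇)
    (BRep : Submodule (ZMod 8) (Fin (m₁ + m₂ + m₃ + m₄ + m₅ + m₆ + m₇) → ZMod 8))
    (hB : BRep = Submodule.span (ZMod 8) {blockVec m₁ m₂ m₃ m₄ m₅ m₆ m₇}) :
    2 * covRadius (distOf wE)
        (BRep : Set (Fin (m₁ + m₂ + m₃ + m₄ + m₅ + m₆ + m₇) → ZMod 8)) =
      11 * (m₁ + m₃ + m₅ + m₇) + 12 * (m₂ + m₆) + 16 * m₄ := by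
  subst hB
  rw [← sum_maxAverage_blockVec]
  exact two_mul_covRadius_span_singleton fun k =>
    (two_mul_distOf_wE_blockVec h₁ h₂ h₃ h₄ h₅ h₆ h₇ k).trans (sum_maxAverage_blockVec ..).symm
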